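/- Fix an integer k ≥ 3 and a real r > 0, and set q = 1 − 2^{1−k}. The determinant of the 3×3 matrix of second partial derivatives, at (ζ₁,ζ₂,ζ₃) = (1/4,1/4,1/4), of the function (ζ₁,ζ₂,ζ₃) ↦ g_r(ζ₁+ζ₂, ζ₁+ζ₃, ζ₁) equals 256 (2^k − 2 − 2kr + 2k²r)² / (2^{4k} q⁴) · (4k(k−1)r − 2^{2k} q²). In particular this determinant is strictly negative whenever 4k(k−1)r < 2^{2k} q². -/

import Mathlib

open Real

/-- `p(α,β,γ)`: the probability that a random `k`-subset is bichromatic under both of a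
pair of colorings with black densities `α`, `β` and overlap `γ`. -/
noncomputable def hypP (k : ℕ) (α β γ : ℝ) : ℝ :=
  1 - α ^ k - (1 - α) ^ k - β ^ k - (1 - β) ^ k + γ ^ k + (α - γ) ^ k
    + (β - γ) ^ k + (1 - α - β + γ) ^ k

/-- The second-moment rate function
`g_r(α,β,γ) = (p(α,β,γ)/q²)^r / (4 γ^γ (α−γ)^{α−γ} (β−γ)^{β−γ} (1−α−β+γ)^{1−α−β+γ})`
with `q = 1 − 2^{1−k}` and the convention `0^0 = 1` (satisfied by `Real.rpow`). -/
noncomputable def hypG (k : ℕ) (r : ℝ) (α β γ : ℝ) : ℝ :=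
  (hypP k α β γ / (1 - (2 : ℝ) ^ (1 - (k : ℝ))) ^ 2) ^ r /
    (4 * γ ^ γ * (α - γ) ^ (α - γ) * (β - γ) ^ (β - γ) *
      (1 - α - β + γ) ^ (1 - α - β + γ))

/-- The second partial derivative of `g` at `x` in the coordinate directions `i`, `j`. -/
noncomputable def hessEntry {e : ℕ} (g : (Fin e → ℝ) → ℝ) (x : Fin e → ℝ)
    (i j : Fin e) : ℝ :=
  fderiv ℝ (fun y => fderiv ℝ g y (Pi.single j 1)) x (Pi.single i 1)

/-- The function under study, in the coordinates `ζ`. -/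
noncomputable def auxP (k : ℕ) (z : Fin 3 → ℝ) : ℝ :=
  1 - (z 0 + z 1) ^ k - (1 - (z 0 + z 1)) ^ k - (z 0 + z 2) ^ k - (1 - (z 0 + z 2)) ^ k
    + z 0 ^ k + z 1 ^ k + z 2 ^ k + (1 - z 0 - z 1 - z 2) ^ k

/-- Directional derivative of `auxP`. -/
noncomputable def auxPD (k : ℕ) (v z : Fin 3 → ℝ) : ℝ :=
  k * (-(v 0 + v 1) * (z 0 + z 1) ^ (k - 1) + (v 0 + v 1) * (1 - (z 0 + z 1)) ^ (k - 1)
    - (v 0 + v 2) * (z 0 + z 2) ^ (k - 1) + (v 0 + v 2) * (1 - (z 0 + z 2)) ^ (k - 1)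
    + v 0 * z 0 ^ (k - 1) + v 1 * z 1 ^ (k - 1) + v 2 * z 2 ^ (k - 1)
    - (v 0 + v 1 + v 2) * (1 - z 0 - z 1 - z 2) ^ (k - 1))

/-- The logarithm of the function. -/
noncomputable def auxL (k : ℕ) (r Q : ℝ) (z : Fin 3 → ℝ) : ℝ :=
  r * (log (auxP k z) - log Q) - log 4 - log (z 0) * z 0 - log (z 1) * z 1 - log (z 2) * z 2
    - log (1 - z 0 - z 1 - z 2) * (1 - z 0 - z 1 - z 2)

/-- Directional derivative of `auxL`. -/
noncomputable def auxLD (k : ℕ) (r : ℝ) (v z : Fin 3 → ℝ) : ℝ :=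
  r * (auxPD k v z / auxP k z) - v 0 * log (z 0) - v 1 * log (z 1) - v 2 * log (z 2)
    + (v 0 + v 1 + v 2) * log (1 - z 0 - z 1 - z 2)

/-- The region where everything is smooth. -/
def auxU (k : ℕ) : Set (Fin 3 → ℝ) :=
  {z | 0 < z 0 ∧ 0 < z 1 ∧ 0 < z 2 ∧ 0 < 1 - z 0 - z 1 - z 2 ∧ 0 < auxP k z}

lemma auxU_open (k : ℕ) : IsOpen (auxU k) := by
  unfold auxU auxP
  refine IsOpen.and (isOpen_lt (by fun_prop) (by fun_prop)) ?_
  refine IsOpen.and (isOpen_lt (by fun_prop) (by fun_prop)) ?_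
  refine IsOpen.and (isOpen_lt (by fun_prop) (by fun_prop)) ?_
  refine IsOpen.and (isOpen_lt (by fun_prop) (by fun_prop)) ?_
  exact isOpen_lt (by fun_prop) (by fun_prop)

lemma aux_lin (c d t : ℝ) : HasDerivAt (fun t : ℝ => c + t * d) d t := by
  simpa using ((hasDerivAt_id t).mul_const d).const_add c

lemma auxP_line (k : ℕ) (y v : Fin 3 → ℝ) :
    HasDerivAt (fun t : ℝ => auxP k (y + t • v)) (auxPD k v y) 0 := by
  have h0 := aux_lin (y 0) (v 0) 0
  have h1 := aux_lin (y 1) (v 1) 0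
  have h2 := aux_lin (y 2) (v 2) 0
  have := ((((((((h0.add h1).pow k).const_sub 1).sub (((h0.add h1).const_sub 1).pow k)).sub
    ((h0.add h2).pow k)).sub (((h0.add h2).const_sub 1).pow k)).add (h0.pow k)).add
    (h1.pow k)).add (h2.pow k) |>.add ((((h0.const_sub 1).sub h1).sub h2).pow k)
  refine this.congr_deriv ?_
  simp [auxPD]
  ring

lemma aux_xlogx (c d : ℝ) (hc : 0 < c) :
    HasDerivAt (fun t : ℝ => log (c + t * d) * (c + t * d)) (d * log c + d) 0 := by
  have h := aux_lin c d 0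
  refine ((h.log (by simpa using hc.ne')).mul h).congr_deriv ?_
  simp
  field_simp
  ring

lemma aux_log (c d : ℝ) (hc : 0 < c) :
    HasDerivAt (fun t : ℝ => log (c + t * d)) (d / c) 0 := by
  have h := aux_lin c d 0
  refine (h.log (by simpa using hc.ne')).congr_deriv ?_
  simp

lemma auxL_line (k : ℕ) (r Q : ℝ) (y v : Fin 3 → ℝ) (hy : y ∈ auxU k) :
    HasDerivAt (fun t : ℝ => auxL k r Q (y + t • v)) (auxLD k r v y) 0 := by
  obtain ⟨a0, a1, a2, a3, aP⟩ := hy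
  have hP := (auxP_line k y v).log (by simpa using aP.ne')
  have := ((((((hP.sub_const (log Q)).const_mul r).sub_const (log 4)).sub
    (aux_xlogx _ (v 0) a0)).sub (aux_xlogx _ (v 1) a1)).sub (aux_xlogx _ (v 2) a2)).sub
    (aux_xlogx _ (-(v 0 + v 1 + v 2)) a3)
  have h2 := this.congr_deriv (g' := auxLD k r v y) (by simp [auxLD]; ring)
  refine h2.congr_of_eventuallyEq (Filter.Eventually.of_forall fun t => ?_)
  have e : 1 - (y 0 + t * v 0) - (y 1 + t * v 1) - (y 2 + t * v 2)
    = 1 - y 0 - y 1 - y 2 + t * -(v 0 + v 1 + v 2) := by ring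
  simp only [auxL, Pi.add_apply, Pi.smul_apply, smul_eq_mul, e, Pi.sub_apply]

lemma auxL_diff (k : ℕ) (r Q : ℝ) (y : Fin 3 → ℝ) (hy : y ∈ auxU k) :
    DifferentiableAt ℝ (auxL k r Q) y := by
  obtain ⟨a0, a1, a2, a3, aP⟩ := hy
  have hP : DifferentiableAt ℝ (auxP k) y := by unfold auxP; fun_prop
  unfold auxL
  have := a0.ne'
  have := a1.ne'
  have := a2.ne'
  have := a3.ne'
  have := aP.ne'
  fun_prop (disch := assumption)

lemma auxLD_diff (k : ℕ) (r : ℝ) (v y : Fin 3 → ℝ) (hy : y ∈ auxU k) :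
    DifferentiableAt ℝ (auxLD k r v) y := by
  obtain ⟨a0, a1, a2, a3, aP⟩ := hy
  have hP : DifferentiableAt ℝ (auxP k) y := by unfold auxP; fun_prop
  have hPD : DifferentiableAt ℝ (auxPD k v) y := by unfold auxPD; fun_prop
  unfold auxLD
  have := a0.ne'
  have := a1.ne'
  have := a2.ne'
  have := a3.ne'
  have := aP.ne'
  fun_prop (disch := assumption)

lemma aux_fderiv_of_line {f : (Fin 3 → ℝ) → ℝ} {y v : Fin 3 → ℝ} {d : ℝ}
    (hf : DifferentiableAt ℝ f y) (h : HasDerivAt (fun t : ℝ => f (y + t • v)) d 0) :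
    fderiv ℝ f y v = d := by
  rw [← hf.lineDeriv_eq_fderiv]
  exact h.deriv

lemma aux_q (k : ℕ) : (2 : ℝ) ^ (1 - (k : ℝ)) = 2 * (1 / 2) ^ k := by
  rw [Real.rpow_sub (by norm_num), Real.rpow_one, Real.rpow_natCast]
  simp [div_eq_mul_inv]

lemma aux_eq (k : ℕ) (r q : ℝ) (hq0 : 0 < q) (hq : q = 1 - (2 : ℝ) ^ (1 - (k : ℝ)))
    (z : Fin 3 → ℝ) (hz : z ∈ auxU k) :
    hypG k r (z 0 + z 1) (z 0 + z 2) (z 0) = exp (auxL k r (q ^ 2) z) := by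
  obtain ⟨a0, a1, a2, a3, aP⟩ := hz
  have e1 : z 0 + z 1 - z 0 = z 1 := by ring
  have e2 : z 0 + z 2 - z 0 = z 2 := by ring
  have e3 : 1 - (z 0 + z 1) - (z 0 + z 2) + z 0 = 1 - z 0 - z 1 - z 2 := by ring
  have eP : hypP k (z 0 + z 1) (z 0 + z 2) (z 0) = auxP k z := by
    unfold hypP auxP
    rw [e1, e2, e3]
  unfold hypG
  rw [eP, e1, e2, e3, ← hq, rpow_def_of_pos (div_pos aP (by positivity)), rpow_def_of_pos a0,
    rpow_def_of_pos a1, rpow_def_of_pos a2, rpow_def_of_pos a3,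
    Real.log_div aP.ne' (by positivity)]
  unfold auxL
  simp only [Real.exp_sub]
  rw [Real.exp_log (by norm_num : (0 : ℝ) < 4), mul_comm r]
  simp only [div_div]

/-- The second derivative of `auxP` at the center. -/
lemma auxPD_line (m : ℕ) (v w : Fin 3 → ℝ) :
    HasDerivAt (fun t : ℝ => auxPD (m + 2) v ((fun _ => 1 / 4) + t • w))
      (((m : ℝ) + 2) * (m + 1) * (-2 * (1 / 2) ^ m * ((v 0 + v 1) * (w 0 + w 1)
        + (v 0 + v 2) * (w 0 + w 2)) + ((1 / 2) ^ m) ^ 2 * (v 0 * w 0 + v 1 * w 1 + v 2 * w 2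
        + (v 0 + v 1 + v 2) * (w 0 + w 1 + w 2)))) 0 := by
  have h0 := aux_lin (1 / 4) (w 0) 0
  have h1 := aux_lin (1 / 4) (w 1) 0
  have h2 := aux_lin (1 / 4) (w 2) 0
  have := ((((((((((h0.add h1).pow (m + 1)).const_mul (-(v 0 + v 1))).add
    ((((h0.add h1).const_sub 1).pow (m + 1)).const_mul (v 0 + v 1))).sub
    (((h0.add h2).pow (m + 1)).const_mul (v 0 + v 2))).add
    ((((h0.add h2).const_sub 1).pow (m + 1)).const_mul (v 0 + v 2))).add
    ((h0.pow (m + 1)).const_mul (v 0))).add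
    ((h1.pow (m + 1)).const_mul (v 1))).add ((h2.pow (m + 1)).const_mul (v 2))).sub
    (((((h0.const_sub 1).sub h1).sub h2).pow (m + 1)).const_mul (v 0 + v 1 + v 2))).const_mul
    ((m : ℝ) + 2)
  have h2 := this.congr_deriv (g' := (((m : ℝ) + 2) * (m + 1) * (-2 * (1 / 2) ^ m *
        ((v 0 + v 1) * (w 0 + w 1)
        + (v 0 + v 2) * (w 0 + w 2)) + ((1 / 2) ^ m) ^ 2 * (v 0 * w 0 + v 1 * w 1 + v 2 * w 2
        + (v 0 + v 1 + v 2) * (w 0 + w 1 + w 2))))) (by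
    have e4 : ((1 / 2 : ℝ) ^ m) ^ 2 = (1 / 4) ^ m := by
      rw [← pow_mul, mul_comm, pow_mul]; norm_num
    rw [e4]
    simp only [Pi.add_apply, Pi.sub_apply, zero_mul, add_zero, Nat.add_sub_cancel]
    norm_num
    ring)
  refine h2.congr_of_eventuallyEq (Filter.Eventually.of_forall fun t => ?_)
  simp [auxPD]

lemma auxPD_center (k : ℕ) (v : Fin 3 → ℝ) : auxPD k v (fun _ => 1 / 4) = 0 := by
  unfold auxPD
  norm_num
  right
  ring

lemma auxP_center (k : ℕ) : auxP k (fun _ => 1 / 4) = (1 - 2 * (1 / 2) ^ k) ^ 2 := by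
  have e4 : (1 / 4 : ℝ) ^ k = ((1 / 2) ^ k) ^ 2 := by
    rw [← pow_mul, mul_comm, pow_mul]; norm_num
  unfold auxP
  norm_num at e4 ⊢
  rw [e4]
  ring

/-- The second derivative of `auxL` at the center. -/
lemma auxLD_line (m : ℕ) (r q : ℝ) (hq0 : 0 < q) (hq : q = 1 - 2 * (1 / 2) ^ (m + 2))
    (v w : Fin 3 → ℝ) :
    HasDerivAt (fun t : ℝ => auxLD (m + 2) r v ((fun _ => 1 / 4) + t • w))
      (r * ((((m : ℝ) + 2) * (m + 1) * (-2 * (1 / 2) ^ m * ((v 0 + v 1) * (w 0 + w 1)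
        + (v 0 + v 2) * (w 0 + w 2)) + ((1 / 2) ^ m) ^ 2 * (v 0 * w 0 + v 1 * w 1 + v 2 * w 2
        + (v 0 + v 1 + v 2) * (w 0 + w 1 + w 2)))) / q ^ 2) - 4 * (v 0 * w 0 + v 1 * w 1 + v 2 * w 2
        + (v 0 + v 1 + v 2) * (w 0 + w 1 + w 2))) 0 := by
  have hP := auxP_line (m + 2) (fun _ => 1 / 4) w
  have hc := auxP_center (m + 2)
  rw [← hq] at hc
  have hPD := auxPD_line m v w
  have hl := fun d => aux_log (1 / 4) d (by norm_num)
  have hd := hPD.div hP (by simp only [zero_smul, add_zero]; rw [hc]; positivity)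
  have := ((((hd.const_mul r).sub ((hl (w 0)).const_mul (v 0))).sub
    ((hl (w 1)).const_mul (v 1))).sub ((hl (w 2)).const_mul (v 2))).add
    ((hl (-(w 0 + w 1 + w 2))).const_mul (v 0 + v 1 + v 2))
  simp only [zero_smul, add_zero] at this
  rw [hc, auxPD_center, auxPD_center] at this
  have h2 := this.congr_deriv (g' := _) (by
    rw [zero_mul, sub_zero, pow_two (q ^ 2), mul_div_mul_right _ _ (by positivity)])
  refine (h2.congr_deriv ?_).congr_of_eventuallyEq (Filter.Eventually.of_forall fun t => ?_)
  · ring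
  have e : 1 - (1 / 4 + t * w 0) - (1 / 4 + t * w 1) - (1 / 4 + t * w 2)
    = 1 / 4 + t * -(w 0 + w 1 + w 2) := by ring
  simp only [auxLD, Pi.add_apply, Pi.smul_apply, smul_eq_mul, e, Pi.sub_apply, Pi.div_apply]

lemma auxL_center (k : ℕ) (r q : ℝ) (hq : q = 1 - 2 * (1 / 2) ^ k) :
    auxL k r (q ^ 2) (fun _ => 1 / 4) = 0 := by
  unfold auxL
  rw [auxP_center, hq]
  have : log (1 / 4 : ℝ) = - log 4 := by rw [one_div, Real.log_inv]
  norm_num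
  rw [this]
  ring

lemma auxLD_center (k : ℕ) (r : ℝ) (v : Fin 3 → ℝ) :
    auxLD k r v (fun _ => 1 / 4) = 0 := by
  unfold auxLD
  rw [auxPD_center]
  norm_num
  ring

lemma aux_hess (m : ℕ) (r q : ℝ) (hq0 : 0 < q)
    (hq : q = 1 - (2 : ℝ) ^ (1 - ((m + 2 : ℕ) : ℝ))) (i j : Fin 3) :
    hessEntry (fun ζ : Fin 3 → ℝ => hypG (m + 2) r (ζ 0 + ζ 1) (ζ 0 + ζ 2) (ζ 0))
      (fun _ => 1 / 4) i j = (fun v w : Fin 3 → ℝ =>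
      (r * ((((m : ℝ) + 2) * (m + 1) * (-2 * (1 / 2) ^ m * ((v 0 + v 1) * (w 0 + w 1)
        + (v 0 + v 2) * (w 0 + w 2)) + ((1 / 2) ^ m) ^ 2 * (v 0 * w 0 + v 1 * w 1 + v 2 * w 2
        + (v 0 + v 1 + v 2) * (w 0 + w 1 + w 2)))) / q ^ 2) - 4 * (v 0 * w 0 + v 1 * w 1 + v 2 * w 2
        + (v 0 + v 1 + v 2) * (w 0 + w 1 + w 2)))) (Pi.single j 1) (Pi.single i 1) := by
  have hq' : q = 1 - 2 * (1 / 2) ^ (m + 2) := by rw [hq, aux_q]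
  have hx : (fun _ => 1 / 4 : Fin 3 → ℝ) ∈ auxU (m + 2) := by
    refine ⟨by norm_num, by norm_num, by norm_num, by norm_num, ?_⟩
    rw [auxP_center, ← hq']
    positivity
  have hU := auxU_open (m + 2)
  have hfirst : ∀ v : Fin 3 → ℝ, ∀ y ∈ auxU (m + 2),
      fderiv ℝ (fun ζ : Fin 3 → ℝ => hypG (m + 2) r (ζ 0 + ζ 1) (ζ 0 + ζ 2) (ζ 0)) y v
        = exp (auxL (m + 2) r (q ^ 2) y) * auxLD (m + 2) r v y := by
    intro v y hy
    have he : (fun ζ : Fin 3 → ℝ => hypG (m + 2) r (ζ 0 + ζ 1) (ζ 0 + ζ 2) (ζ 0)) =ᶠ[nhds y]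
        fun z => exp (auxL (m + 2) r (q ^ 2) z) := by
      filter_upwards [hU.mem_nhds hy] with z hz using aux_eq _ r q hq0 hq z hz
    rw [he.fderiv_eq]
    refine aux_fderiv_of_line (auxL_diff _ r _ y hy).exp ?_
    simpa using (auxL_line (m + 2) r (q ^ 2) y v hy).exp
  unfold hessEntry
  generalize (Pi.single j 1 : Fin 3 → ℝ) = v
  generalize (Pi.single i 1 : Fin 3 → ℝ) = w
  have he : (fun y => fderiv ℝ (fun ζ : Fin 3 → ℝ =>
      hypG (m + 2) r (ζ 0 + ζ 1) (ζ 0 + ζ 2) (ζ 0)) y v) =ᶠ[nhds (fun _ => 1 / 4)]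
      fun y => exp (auxL (m + 2) r (q ^ 2) y) * auxLD (m + 2) r v y := by
    filter_upwards [hU.mem_nhds hx] with z hz using hfirst v z hz
  rw [he.fderiv_eq]
  refine aux_fderiv_of_line ((auxL_diff _ r _ _ hx).exp.mul (auxLD_diff _ r v _ hx)) ?_
  have := (auxL_line (m + 2) r (q ^ 2) _ w hx).exp.mul (auxLD_line m r q hq0 hq' v w)
  simp only [zero_smul, add_zero, auxLD_center, auxL_center _ r q hq', Real.exp_zero, one_mul,
    mul_zero, zero_add] at this
  exact this

/-- For k ≥ 3, r > 0 and q = 1 − 2^{1−k}, the Hessian determinant at (1/4,1/4,1/4) of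
(ζ₁,ζ₂,ζ₃) ↦ g_r(ζ₁+ζ₂, ζ₁+ζ₃, ζ₁) equals
256 (2^k − 2 − 2kr + 2k²r)²/(2^{4k} q⁴) · (4k(k−1)r − 2^{2k} q²); in particular it is
strictly negative whenever 4k(k−1)r < 2^{2k} q². -/
theorem hypG_hessian_det (k : ℕ) (hk : 3 ≤ k) (r : ℝ) (hr : 0 < r) (q : ℝ)
    (hq : q = 1 - (2 : ℝ) ^ (1 - (k : ℝ))) :
    Matrix.det (Matrix.of fun i j =>
        hessEntry (fun ζ : Fin 3 → ℝ => hypG k r (ζ 0 + ζ 1) (ζ 0 + ζ 2) (ζ 0))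
          (fun _ => 1 / 4) i j) =
      256 * ((2 : ℝ) ^ k - 2 - 2 * k * r + 2 * (k : ℝ) ^ 2 * r) ^ 2 /
        ((2 : ℝ) ^ (4 * k) * q ^ 4) *
        (4 * k * ((k : ℝ) - 1) * r - (2 : ℝ) ^ (2 * k) * q ^ 2) ∧
      (4 * k * ((k : ℝ) - 1) * r < (2 : ℝ) ^ (2 * k) * q ^ 2 →
        Matrix.det (Matrix.of fun i j =>
          hessEntry (fun ζ : Fin 3 → ℝ => hypG k r (ζ 0 + ζ 1) (ζ 0 + ζ 2) (ζ 0))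
            (fun _ => 1 / 4) i j) < 0) := by
  have hk2 : ∃ m, k = m + 2 := ⟨k - 2, by omega⟩
  obtain ⟨m, rfl⟩ := hk2
  have hq' : q = 1 - 2 * (1 / 2) ^ (m + 2) := by rw [hq, aux_q]
  have ha : (1 / 2 : ℝ) ^ m ≤ 1 := pow_le_one₀ (by norm_num) (by norm_num)
  have hq0 : 0 < q := by rw [hq', pow_add]; linarith
  have hb : (2 : ℝ) ^ m * (1 / 2) ^ m = 1 := by rw [← mul_pow]; norm_num
  have hb1 : (1 : ℝ) ≤ 2 ^ m := one_le_pow₀ (by norm_num)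
  have hpos : 0 < (2 : ℝ) ^ (m + 2) - 2 - 2 * ((m + 2 : ℕ) : ℝ) * r
      + 2 * ((m + 2 : ℕ) : ℝ) ^ 2 * r := by
    have : 0 < 2 * ((m : ℝ) + 2) * (m + 1) * r := by positivity
    push_cast
    rw [pow_add]
    nlinarith
  have key : Matrix.det (Matrix.of fun i j =>
        hessEntry (fun ζ : Fin 3 → ℝ => hypG (m + 2) r (ζ 0 + ζ 1) (ζ 0 + ζ 2) (ζ 0))
          (fun _ => 1 / 4) i j) =
      256 * ((2 : ℝ) ^ (m + 2) - 2 - 2 * ((m + 2 : ℕ) : ℝ) * r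
        + 2 * ((m + 2 : ℕ) : ℝ) ^ 2 * r) ^ 2 /
        ((2 : ℝ) ^ (4 * (m + 2)) * q ^ 4) *
        (4 * ((m + 2 : ℕ) : ℝ) * (((m + 2 : ℕ) : ℝ) - 1) * r
          - (2 : ℝ) ^ (2 * (m + 2)) * q ^ 2) := by
    rw [Matrix.det_fin_three]
    simp only [Matrix.of_apply, aux_hess m r q hq0 hq]
    simp
    have hqb : q = (2 * 2 ^ m - 1) / (2 * 2 ^ m) := by
      rw [hq', pow_add]
      field_simp
      linear_combination (-1 : ℝ) * hb
    have hne : (2 * 2 ^ m - 1 : ℝ) ≠ 0 := by linarith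
    have e4 : (2 : ℝ) ^ (4 * (m + 2)) = 256 * (2 ^ m) ^ 4 := by ring
    have e2 : (2 : ℝ) ^ (2 * (m + 2)) = 16 * (2 ^ m) ^ 2 := by ring
    have e1 : (2 : ℝ) ^ (m + 2) = 4 * 2 ^ m := by ring
    rw [e4, e2, e1, hqb]
    have hb0 : (2 : ℝ) ^ m ≠ 0 := by positivity
    generalize (2 : ℝ) ^ m = b at *
    field_simp
    ring
  refine ⟨key, fun hlt => ?_⟩
  rw [key]
  exact mul_neg_of_pos_of_neg (by positivity) (by linarith)
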